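/- The function f₄(x) = sin x / (x·(cos x − e^{x·cot x − 1} + 1)) is strictly increasing on (0, π/2), with limit 1 as x → 0⁺ and limit c = 2e/(π(e−1)) as x → π/2⁻; in particular its range on (0, π/2) is the interval (1, c). -/

import Mathlib

open Real

/-- f₄(x) = sin x / (x·(cos x − e^{x·cot x − 1} + 1)), with cot x = cos x / sin x -/
noncomputable def f₄ (x : ℝ) : ℝ :=
  Real.sin x / (x * (Real.cos x - Real.exp (x * (Real.cos x / Real.sin x) - 1) + 1))

open Filter Set Topology

theorem lt_of_strictMonoOn_of_tendsto_left {f : ℝ → ℝ} {a b l : ℝ}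
    (hf : StrictMonoOn f (Ioo a b)) (hl : Tendsto f (𝓝[>] a) (𝓝 l)) {x : ℝ}
    (hx : x ∈ Ioo a b) : l < f x := by
  obtain ⟨y, hay, hyx⟩ := exists_between hx.1
  have hy : y ∈ Ioo a b := ⟨hay, hyx.trans hx.2⟩
  refine lt_of_le_of_lt (le_of_tendsto hl ?_) (hf hy hx hyx)
  filter_upwards [Ioo_mem_nhdsGT hay] with z hz
  exact (hf ⟨hz.1, hz.2.trans hy.2⟩ hy hz.2).le

theorem lt_of_strictMonoOn_of_tendsto_right {f : ℝ → ℝ} {a b l : ℝ}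
    (hf : StrictMonoOn f (Ioo a b)) (hl : Tendsto f (𝓝[<] b) (𝓝 l)) {x : ℝ}
    (hx : x ∈ Ioo a b) : f x < l := by
  obtain ⟨y, hxy, hyb⟩ := exists_between hx.2
  have hy : y ∈ Ioo a b := ⟨hx.1.trans hxy, hyb⟩
  refine lt_of_lt_of_le (hf hx hy hxy) (ge_of_tendsto hl ?_)
  filter_upwards [Ioo_mem_nhdsLT hyb] with z hz
  exact (hf hy ⟨hy.1.trans hz.1, hz.2⟩ hz.1).le

theorem pos_of_deriv_pos_Ioo {f f' : ℝ → ℝ} {b : ℝ} (h0 : f 0 = 0)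
    (hd : ∀ x, HasDerivAt f (f' x) x) (hpos : ∀ x ∈ Ioo 0 b, 0 < f' x) {x : ℝ}
    (hx : x ∈ Ioo 0 b) : 0 < f x := by
  have hmono : StrictMonoOn f (Ico 0 b) := by
    refine strictMonoOn_of_deriv_pos (convex_Ico 0 b)
      (fun y _ => (hd y).continuousAt.continuousWithinAt) fun y hy => ?_
    rw [interior_Ico] at hy
    rw [(hd y).deriv]
    exact hpos y hy
  have := hmono ⟨le_rfl, hx.1.trans hx.2⟩ ⟨hx.1.le, hx.2⟩ hx.1
  rwa [h0] at this

theorem sin_pos_and_cos_pos {x : ℝ} (hx : x ∈ Ioo 0 (π / 2)) : 0 < sin x ∧ 0 < cos x :=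
  ⟨sin_pos_of_pos_of_lt_pi hx.1 (by linarith [hx.2, pi_pos]),
    cos_pos_of_mem_Ioo ⟨by linarith [hx.1, pi_pos], hx.2⟩⟩

/-- The Cusa–Huygens inequality at the doubled angle `2 * x`. -/
theorem cusa_huygens_double {x : ℝ} (hx : x ∈ Ioo 0 (π / 2)) :
    0 < x + 2 * x * cos x ^ 2 - 3 * (sin x * cos x) := by
  refine pos_of_deriv_pos_Ioo (b := π / 2)
    (f := fun x => x + 2 * x * cos x ^ 2 - 3 * (sin x * cos x))
    (f' := fun x => 4 * sin x * (sin x - x * cos x)) (by simp) (fun y => ?_)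
    (fun y hy => ?_) hx
  · have h := ((hasDerivAt_id y).add (((hasDerivAt_id y).const_mul 2).mul
      ((hasDerivAt_cos y).pow 2))).sub (((hasDerivAt_sin y).mul (hasDerivAt_cos y)).const_mul 3)
    refine h.congr_deriv ?_
    simp
    linear_combination (-1 : ℝ) * sin_sq_add_cos_sq y
  · obtain ⟨hs, hc⟩ := sin_pos_and_cos_pos hy
    have ht := lt_tan hy.1 hy.2
    rw [tan_eq_sin_div_cos, lt_div_iff₀ hc] at ht
    have : 0 < sin y - y * cos y := by linarith
    positivity

/-- The second Wilker inequality, cleared of denominators. -/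
theorem wilker {x : ℝ} (hx : x ∈ Ioo 0 (π / 2)) :
    0 < x ^ 2 + x * (sin x * cos x) - 2 * sin x ^ 2 := by
  refine pos_of_deriv_pos_Ioo (b := π / 2)
    (f := fun x => x ^ 2 + x * (sin x * cos x) - 2 * sin x ^ 2)
    (f' := fun x => x + 2 * x * cos x ^ 2 - 3 * (sin x * cos x)) (by simp) (fun y => ?_)
    (fun y hy => cusa_huygens_double hy) hx
  have h := (((hasDerivAt_id y).pow 2).add ((hasDerivAt_id y).mul
    ((hasDerivAt_sin y).mul (hasDerivAt_cos y)))).sub (((hasDerivAt_sin y).pow 2).const_mul 2)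
  refine h.congr_deriv ?_
  simp
  linear_combination (-y) * sin_sq_add_cos_sq y

theorem tendsto_sin_div_self : Tendsto (fun x : ℝ => sin x / x) (𝓝[>] 0) (𝓝 1) := by
  have h := (hasDerivAt_sin 0).tendsto_slope_zero_right
  simpa [div_eq_inv_mul] using h

theorem tendsto_cos_nhdsGT_zero : Tendsto cos (𝓝[>] 0) (𝓝 1) := by
  have h := continuous_cos.tendsto 0
  rw [cos_zero] at h
  exact h.mono_left nhdsWithin_le_nhds

theorem tendsto_mul_cot : Tendsto (fun x : ℝ => x * (cos x / sin x)) (𝓝[>] 0) (𝓝 1) := by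
  have h := tendsto_cos_nhdsGT_zero.div tendsto_sin_div_self one_ne_zero
  rw [div_one] at h
  refine h.congr fun x => ?_
  simp only [Pi.div_apply, div_div_eq_mul_div]
  ring

theorem hasDerivAt_mul_cot {x : ℝ} (hs : sin x ≠ 0) :
    HasDerivAt (fun x => x * (cos x / sin x)) (cos x / sin x - x / sin x ^ 2) x := by
  refine ((hasDerivAt_id x).mul ((hasDerivAt_cos x).div (hasDerivAt_sin x) hs)).congr_deriv ?_
  simp
  field_simp
  linear_combination (-x) * sin_sq_add_cos_sq x

theorem exp_mul_cot_sub_one_lt {x : ℝ} (hx : x ∈ Ioo 0 (π / 2)) :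
    exp (x * (cos x / sin x) - 1) < sin x * (1 + cos x) / (x + sin x) := by
  set h : ℝ → ℝ := fun x => log (sin x) + log (1 + cos x) - log (x + sin x) -
    (x * (cos x / sin x) - 1) with hh
  have hd : ∀ y ∈ Ioo 0 (π / 2), HasDerivAt h
      ((y ^ 2 + y * (sin y * cos y) - 2 * sin y ^ 2) / (sin y ^ 2 * (y + sin y))) y := by
    intro y hy
    obtain ⟨hs, hc⟩ := sin_pos_and_cos_pos hy
    have hys : y + sin y ≠ 0 := by linarith [hy.1]
    have hc1 : 1 + cos y ≠ 0 := by linarith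
    refine (((((hasDerivAt_sin y).log hs.ne').add
      (((hasDerivAt_cos y).const_add 1).log hc1)).sub
      (((hasDerivAt_id y).add (hasDerivAt_sin y)).log hys)).sub
      ((hasDerivAt_mul_cot hs.ne').sub_const 1)).congr_deriv ?_
    have e : -sin y / (1 + cos y) = -(1 - cos y) / sin y := by
      rw [div_eq_div_iff hc1 hs.ne']
      linear_combination -sin_sq_add_cos_sq y
    simp only [id, Pi.add_apply]
    rw [e]
    field_simp
    ring
  have hmono : StrictMonoOn h (Ioo 0 (π / 2)) := by
    refine strictMonoOn_of_deriv_pos (convex_Ioo _ _)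
      (fun y hy => (hd y hy).continuousAt.continuousWithinAt) fun y hy => ?_
    rw [interior_Ioo] at hy
    rw [(hd y hy).deriv]
    have := (sin_pos_and_cos_pos hy).1
    have := hy.1
    exact div_pos (wilker hy) (by positivity)
  have hlim : Tendsto h (𝓝[>] 0) (𝓝 0) := by
    have h1 : Tendsto (fun x : ℝ => log (sin x / x * (1 + cos x) / (1 + sin x / x)) -
        (x * (cos x / sin x) - 1)) (𝓝[>] 0) (𝓝 (log (1 * (1 + 1) / (1 + 1)) - (1 - 1))) :=
      ((((tendsto_sin_div_self.mul (tendsto_cos_nhdsGT_zero.const_add 1)).div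
        (tendsto_sin_div_self.const_add 1) (by norm_num)).log (by norm_num))).sub
        (tendsto_mul_cot.sub_const 1)
    have e : log (1 * (1 + 1) / (1 + 1)) - ((1 : ℝ) - 1) = 0 := by norm_num
    rw [e] at h1
    refine h1.congr' ?_
    filter_upwards [Ioo_mem_nhdsGT (show (0 : ℝ) < π / 2 by positivity)] with y hy
    obtain ⟨hs, hc⟩ := sin_pos_and_cos_pos hy
    have hy0 := hy.1
    have e : sin y / y * (1 + cos y) / (1 + sin y / y) = sin y * (1 + cos y) / (y + sin y) := by
      field_simp
    rw [hh, e, log_div (by positivity) (by positivity), log_mul hs.ne' (by positivity)]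
  have hpos := lt_of_strictMonoOn_of_tendsto_left hmono hlim hx
  obtain ⟨hs, hc⟩ := sin_pos_and_cos_pos hx
  have hx0 := hx.1
  rw [← lt_log_iff_exp_lt (by positivity), log_div (by positivity) (by positivity),
    log_mul hs.ne' (by positivity)]
  simp only [hh] at hpos
  linarith

theorem f₄_denominator_pos {x : ℝ} (hx : x ∈ Ioo 0 (π / 2)) :
    0 < cos x - exp (x * (cos x / sin x) - 1) + 1 := by
  obtain ⟨hs, hc⟩ := sin_pos_and_cos_pos hx
  have hx0 := hx.1
  have : sin x * (1 + cos x) / (x + sin x) < 1 + cos x := by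
    rw [div_lt_iff₀ (by positivity)]
    nlinarith
  linarith [exp_mul_cot_sub_one_lt hx]

theorem hasDerivAt_f₄ {x : ℝ} (hx : x ∈ Ioo 0 (π / 2)) :
    HasDerivAt f₄ ((x - sin x) * (sin x * (1 + cos x) -
      exp (x * (cos x / sin x) - 1) * (x + sin x)) /
      (sin x * (x * (cos x - exp (x * (cos x / sin x) - 1) + 1)) ^ 2)) x := by
  have hs := (sin_pos_and_cos_pos hx).1.ne'
  have hD := (f₄_denominator_pos hx).ne'
  have hx0 := hx.1.ne'
  have h := (hasDerivAt_sin x).div ((hasDerivAt_id x).mul (((hasDerivAt_cos x).sub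
    ((hasDerivAt_mul_cot hs).sub_const 1).exp).add_const 1)) (mul_ne_zero hx0 hD)
  refine h.congr_deriv ?_
  simp only [id, Pi.mul_apply, Pi.sub_apply]
  generalize exp (x * (cos x / sin x) - 1) = E at *
  rw [div_eq_div_iff (by positivity) (by positivity), ← mul_assoc]
  congr 1
  field_simp
  linear_combination (x * sin x) * sin_sq_add_cos_sq x

theorem strictMonoOn_f₄ : StrictMonoOn f₄ (Ioo 0 (π / 2)) := by
  refine strictMonoOn_of_deriv_pos (convex_Ioo _ _)
    (fun y hy => (hasDerivAt_f₄ hy).continuousAt.continuousWithinAt) fun y hy => ?_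
  rw [interior_Ioo] at hy
  rw [(hasDerivAt_f₄ hy).deriv]
  have hs := (sin_pos_and_cos_pos hy).1
  have hD := f₄_denominator_pos hy
  have hy0 := hy.1
  have hE := exp_mul_cot_sub_one_lt hy
  rw [lt_div_iff₀ (by positivity)] at hE
  exact div_pos (mul_pos (sub_pos.2 (sin_lt hy0)) (sub_pos.2 hE)) (by positivity)

theorem tendsto_f₄_zero : Tendsto f₄ (𝓝[>] 0) (𝓝 1) := by
  have h : Tendsto (fun x : ℝ => sin x / x / (cos x - exp (x * (cos x / sin x) - 1) + 1))
      (𝓝[>] 0) (𝓝 (1 / (1 - exp (1 - 1) + 1))) :=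
    tendsto_sin_div_self.div ((tendsto_cos_nhdsGT_zero.sub
      ((continuous_exp.tendsto _).comp (tendsto_mul_cot.sub_const 1))).add_const 1) (by simp)
  have e : 1 / (1 - exp (1 - 1) + 1) = 1 := by simp
  rw [e] at h
  exact h.congr fun x => by rw [f₄, div_div]

theorem tendsto_f₄_pi_div_two :
    Tendsto f₄ (𝓝[<] (π / 2)) (𝓝 (2 * exp 1 / (π * (exp 1 - 1)))) := by
  have he : exp (-1) < 1 := exp_lt_one_iff.2 (by norm_num)
  have he1 : (1 : ℝ) < exp 1 := one_lt_exp_iff.2 one_pos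
  have hc : ContinuousAt f₄ (π / 2) := by
    unfold f₄
    refine continuous_sin.continuousAt.div (continuousAt_id.mul
      (((continuous_cos.continuousAt.sub ((continuousAt_id.mul
        (continuous_cos.continuousAt.div continuous_sin.continuousAt ?_)).sub
        continuousAt_const).rexp).add continuousAt_const))) ?_
    · simp
    · simp only [cos_pi_div_two, sin_pi_div_two, zero_div, mul_zero, zero_sub]
      exact (mul_pos (by positivity) (by linarith)).ne'
  have hv : f₄ (π / 2) = 2 * exp 1 / (π * (exp 1 - 1)) := by
    have h2 : exp 1 - 1 ≠ 0 := by linarith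
    have h3 : -(exp 1)⁻¹ + 1 ≠ 0 := by
      rw [← exp_neg]
      linarith
    simp only [f₄, cos_pi_div_two, sin_pi_div_two, zero_div, mul_zero, zero_sub, exp_neg]
    rw [div_eq_div_iff (by positivity) (by positivity)]
    field_simp
    ring
  rw [← hv]
  exact hc.tendsto.mono_left nhdsWithin_le_nhds

theorem stmt_13 :
    StrictMonoOn f₄ (Set.Ioo 0 (π / 2)) ∧
    Filter.Tendsto f₄ (nhdsWithin 0 (Set.Ioi 0)) (nhds 1) ∧
    Filter.Tendsto f₄ (nhdsWithin (π / 2) (Set.Iio (π / 2)))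
      (nhds (2 * Real.exp 1 / (π * (Real.exp 1 - 1)))) ∧
    f₄ '' Set.Ioo 0 (π / 2) = Set.Ioo 1 (2 * Real.exp 1 / (π * (Real.exp 1 - 1))) := by
  refine ⟨strictMonoOn_f₄, tendsto_f₄_zero, tendsto_f₄_pi_div_two, Subset.antisymm ?_ ?_⟩
  · rintro _ ⟨x, hx, rfl⟩
    exact ⟨lt_of_strictMonoOn_of_tendsto_left strictMonoOn_f₄ tendsto_f₄_zero hx,
      lt_of_strictMonoOn_of_tendsto_right strictMonoOn_f₄ tendsto_f₄_pi_div_two hx⟩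
  · have hpi : (0 : ℝ) < π / 2 := by positivity
    exact isPreconnected_Ioo.intermediate_value_Ioo (le_principal_iff.2 (Ioo_mem_nhdsGT hpi))
      (le_principal_iff.2 (Ioo_mem_nhdsLT hpi))
      (fun y hy => (hasDerivAt_f₄ hy).continuousAt.continuousWithinAt)
      tendsto_f₄_zero tendsto_f₄_pi_div_two
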